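/- Let G be a finite group, X a finite set, and φ, ψ : G → Sym(X) two permutation representations such that for every g ∈ G the number of fixed points of φ(g) on X equals the number of fixed points of ψ(g) on X. Then for every g ∈ G the permutations φ(g) and ψ(g) are conjugate in Sym(X) (equivalently, they have the same cycle type); consequently φ and ψ induce the same map on characters, i.e. χ(φ(g)) = χ(ψ(g)) for every class function χ on Sym(X) and every g ∈ G. -/

import Mathlib

section Aux
open Equiv Equiv.Perm
variable {X : Type*} [Fintype X] [DecidableEq X]

lemma aux_pow (σ : Perm X) (n : ℕ) (x : X) :
    (σ ^ n) x = x ↔ orderOf (σ.cycleOf x) ∣ n := by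
  by_cases h : σ x = x
  · rw [(cycleOf_eq_one_iff σ).2 h]
    simp [pow_apply_eq_self_of_apply_eq_self h n]
  · rw [orderOf_dvd_iff_pow_eq_one, (isCycle_cycleOf σ h).pow_eq_one_iff' (x := x)
      (by rwa [cycleOf_apply_self]), cycleOf_pow_apply_self]

lemma aux_fix (σ : Perm X) (n : ℕ) (hn : n ≠ 0) :
    Fintype.card {x : X // (σ ^ n) x = x} =
      ∑ d ∈ n.divisors, (Finset.univ.filter fun x => orderOf (σ.cycleOf x) = d).card := by
  rw [Fintype.card_subtype, Finset.card_eq_sum_card_fiberwise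
    (f := fun x => orderOf (σ.cycleOf x)) (t := n.divisors)]
  · refine Finset.sum_congr rfl fun d hd => ?_
    congr 1
    ext x
    simp only [Finset.mem_filter, Finset.mem_univ, true_and, aux_pow]
    constructor
    · exact fun h => h.2
    · rintro rfl
      exact ⟨Nat.dvd_of_mem_divisors hd, rfl⟩
  · intro x hx
    simpa [aux_pow, hn] using hx

lemma aux_eq (σ τ : Perm X)
    (h : ∀ n : ℕ, Fintype.card {x : X // (σ ^ n) x = x} =
      Fintype.card {x : X // (τ ^ n) x = x}) (n : ℕ) (hn : n ≠ 0) :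
    (Finset.univ.filter fun x => orderOf (σ.cycleOf x) = n).card =
      (Finset.univ.filter fun x => orderOf (τ.cycleOf x) = n).card := by
  induction n using Nat.strong_induction_on with
  | _ n ih =>
    have := h n
    rw [aux_fix σ n hn, aux_fix τ n hn, ← Nat.insert_self_properDivisors hn,
      Finset.sum_insert Nat.self_notMem_properDivisors,
      Finset.sum_insert Nat.self_notMem_properDivisors,
      Finset.sum_congr rfl fun d hd => ih d (Nat.mem_properDivisors.1 hd).2
        (Nat.pos_of_mem_properDivisors hd).ne'] at this
    exact Nat.add_right_cancel this

lemma aux_count (σ : Perm X) (n : ℕ) (hn : 2 ≤ n) :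
    (Finset.univ.filter fun x => orderOf (σ.cycleOf x) = n).card =
      σ.cycleType.count n * n := by
  have key : ∀ x, orderOf (σ.cycleOf x) = n → σ x ≠ x := by
    intro x hx h
    rw [(cycleOf_eq_one_iff σ).2 h, orderOf_one] at hx
    omega
  rw [Finset.card_eq_sum_card_fiberwise (f := fun x => σ.cycleOf x)
    (t := σ.cycleFactorsFinset.filter fun c => n = c.support.card)]
  · rw [Finset.sum_const_nat (m := n)]
    · rw [cycleType_def, Multiset.count_map]
      rfl
    · intro c hc
      obtain ⟨hc, hcn⟩ := Finset.mem_filter.1 hc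
      have hcyc := (mem_cycleFactorsFinset_iff.1 hc).1
      conv_rhs => rw [hcn]
      congr 1
      ext x
      simp only [Finset.mem_filter, Finset.mem_univ, true_and]
      constructor
      · rintro ⟨h1, rfl⟩
        rw [mem_support, cycleOf_apply_self]
        exact key x h1
      · intro hx
        have := cycle_is_cycleOf hx hc
        rw [← this]
        exact ⟨hcyc.orderOf.trans hcn.symm, rfl⟩
  · intro x hx
    have hx : orderOf (σ.cycleOf x) = n := by simpa using hx
    have h := key x hx
    simp only [Finset.coe_filter, Set.mem_setOf_eq]
    exact ⟨cycleOf_mem_cycleFactorsFinset_iff.2 (mem_support.2 h),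
      by rw [← hx, (isCycle_cycleOf σ h).orderOf]⟩

lemma aux_conj (σ τ : Perm X)
    (h : ∀ n : ℕ, Fintype.card {x : X // (σ ^ n) x = x} =
      Fintype.card {x : X // (τ ^ n) x = x}) : IsConj σ τ := by
  apply isConj_of_cycleType_eq
  ext n
  by_cases hn : 2 ≤ n
  · have := aux_eq σ τ h n (by omega)
    rw [aux_count σ n hn, aux_count τ n hn] at this
    exact Nat.eq_of_mul_eq_mul_right (by omega) this
  · rw [Multiset.count_eq_zero_of_notMem fun h => hn (two_le_of_mem_cycleType h),
      Multiset.count_eq_zero_of_notMem fun h => hn (two_le_of_mem_cycleType h)]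

end Aux

/-!
STATEMENT 11: Let `G` be a finite group, `X` a finite set, and
`φ, ψ : G → Sym(X)` two permutation representations such that for every
`g ∈ G` the permutations `φ g` and `ψ g` have the same number of fixed points
on `X`.  Then for every `g` the permutations `φ g` and `ψ g` are conjugate in
`Sym(X)`; consequently `φ` and `ψ` induce the same map on characters:
`χ (φ g) = χ (ψ g)` for every class function `χ` on `Sym(X)` and every `g`.
-/
theorem stmt11 (G : Type*) [Group G] [Fintype G]
    (X : Type*) [Fintype X] [DecidableEq X]
    (φ ψ : G →* Equiv.Perm X)
    (hchar : ∀ g : G,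
      Fintype.card {x : X // φ g x = x} = Fintype.card {x : X // ψ g x = x}) :
    (∀ g : G, IsConj (φ g) (ψ g)) ∧
      ∀ (χ : Equiv.Perm X → ℂ), (∀ σ τ : Equiv.Perm X, IsConj σ τ → χ σ = χ τ) →
        ∀ g : G, χ (φ g) = χ (ψ g) := by

  have H : ∀ g : G, IsConj (φ g) (ψ g) := fun g => aux_conj _ _ fun n => by
    simpa only [map_pow] using hchar (g ^ n)
  exact ⟨H, fun χ hχ g => hχ _ _ (H g)⟩
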